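/- Let E be a cofinal directed graph with no cycles, and suppose E contains an infinite path f₁f₂… such that for every k ∈ ℕ there exists n ≥ k for which s(fₙ) emits an edge different from fₙ. Then there exist natural numbers n₁ < n₂ < n₃ < … such that the vertices s(f_{n₁}), s(f_{n₂}), … are pairwise distinct and, for each i ∈ ℕ, there exist two distinct paths αᵢ ≠ βᵢ with s(αᵢ) = s(βᵢ) = s(f_{n_i}) and r(αᵢ) = r(βᵢ) = s(f_{n_{i+1}}). -/

import Mathlib

/-- `IsPathFrom src rng l v w` means the finite list of edges `l` is a path
from vertex `v` to vertex `w` in the directed graph with source map `src` and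
range map `rng`.  The empty list is the trivial path at a vertex (so `v = w`). -/
def IsPathFrom {V E : Type*} (src rng : E → V) (l : List E) (v w : V) : Prop :=
  l.Chain' (fun e f => rng e = src f) ∧
  (∀ e ∈ l.head?, src e = v) ∧
  (∀ e ∈ l.getLast?, rng e = w) ∧
  (l = [] → v = w)

/-- `v ≥ w`: there is a path from `v` to `w`. -/
def Reaches {V E : Type*} (src rng : E → V) (v w : V) : Prop :=
  ∃ l : List E, IsPathFrom src rng l v w

/-- An infinite path `e₁e₂…` is a sequence of edges with `r(eᵢ) = s(eᵢ₊₁)`. -/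
def IsInfPath {V E : Type*} (src rng : E → V) (e : ℕ → E) : Prop :=
  ∀ i, rng (e i) = src (e (i + 1))

/-- A graph is cofinal if every vertex can reach some vertex on every infinite path. -/
def Cofinal {V E : Type*} (src rng : E → V) : Prop :=
  ∀ (v : V) (e : ℕ → E), IsInfPath src rng e → ∃ i, Reaches src rng v (src (e i))

/-- A sink is a vertex emitting no edges. -/
def IsSink {V E : Type*} (src : E → V) (v : V) : Prop := ∀ e, src e ≠ v

/-- A singular vertex is a sink or an infinite emitter. -/
def IsSingular {V E : Type*} (src : E → V) (v : V) : Prop :=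
  IsSink src v ∨ {e | src e = v}.Infinite

/-- The graph has no cycles: no nonempty path begins and ends at the same vertex. -/
def HasNoCycles {V E : Type*} (src rng : E → V) : Prop :=
  ∀ (v : V) (l : List E), l ≠ [] → ¬ IsPathFrom src rng l v v

theorem isPathFrom_nil_iff {V E : Type*} (src rng : E → V) (v w : V) :
    IsPathFrom src rng [] v w ↔ v = w := by
  simp [IsPathFrom, List.Chain']

theorem isPathFrom_cons_iff {V E : Type*} (src rng : E → V) (e : E) (l : List E) (v w : V) :
    IsPathFrom src rng (e :: l) v w ↔ src e = v ∧ IsPathFrom src rng l (rng e) w := by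
  cases l with
  | nil => simp [IsPathFrom, List.Chain']
  | cons a l =>
    simp only [IsPathFrom, List.Chain', List.isChain_cons_cons, List.head?_cons,
      List.getLast?_cons_cons, Option.mem_def, Option.some.injEq, forall_eq', reduceCtorEq,
      false_imp_iff, and_true]
    constructor
    · rintro ⟨⟨h1, h2⟩, h3, h4⟩
      exact ⟨h3, h2, h1.symm, h4⟩
    · rintro ⟨h3, h2, h1, h4⟩
      exact ⟨⟨h1.symm, h2⟩, h3, h4⟩

theorem isPathFrom_append {V E : Type*} (src rng : E → V) (l l' : List E) (v w x : V)
    (h : IsPathFrom src rng l v w) (h' : IsPathFrom src rng l' w x) :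
    IsPathFrom src rng (l ++ l') v x := by
  induction l generalizing v with
  | nil => rw [isPathFrom_nil_iff] at h; subst h; exact h'
  | cons e l ih =>
    rw [isPathFrom_cons_iff] at h
    rw [List.cons_append, isPathFrom_cons_iff]
    exact ⟨h.1, ih _ h.2⟩

theorem reaches_seg {V E : Type*} (src rng : E → V) (f : ℕ → E) (hf : IsInfPath src rng f)
    (a b : ℕ) (hab : a ≤ b) : Reaches src rng (src (f a)) (src (f b)) := by
  induction b, hab using Nat.le_induction with
  | base => exact ⟨[], (isPathFrom_nil_iff ..).2 rfl⟩
  | succ b _ ih =>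
    obtain ⟨l, hl⟩ := ih
    refine ⟨l ++ [f b], isPathFrom_append src rng _ _ _ _ _ hl ?_⟩
    rw [isPathFrom_cons_iff, isPathFrom_nil_iff]
    exact ⟨rfl, hf b⟩

/-- In a cofinal graph with no cycles, if an infinite path `f` has the
property that for every `k` there is some `n ≥ k` such that `s(fₙ)` emits an edge
other than `fₙ`, then one can extract indices `n₁ < n₂ < …` with pairwise distinct
vertices `s(f_{nᵢ})` joined, for each `i`, by two distinct paths. -/
theorem doubled_subgraph_of_branching {V E : Type*} (src rng : E → V)
    (hcof : Cofinal src rng) (hnc : HasNoCycles src rng)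
    (f : ℕ → E) (hf : IsInfPath src rng f)
    (hbranch : ∀ k : ℕ, ∃ n ≥ k, ∃ e : E, src e = src (f n) ∧ e ≠ f n) :
    ∃ n : ℕ → ℕ, StrictMono n ∧
      Function.Injective (fun i => src (f (n i))) ∧
      ∀ i : ℕ, ∃ α β : List E, α ≠ β ∧
        IsPathFrom src rng α (src (f (n i))) (src (f (n (i + 1)))) ∧
        IsPathFrom src rng β (src (f (n i))) (src (f (n (i + 1)))) := by
  have key : ∀ k : ℕ, ∃ m, k < m ∧ ∃ α β : List E, α ≠ β ∧
      IsPathFrom src rng α (src (f k)) (src (f m)) ∧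
      IsPathFrom src rng β (src (f k)) (src (f m)) := by
    intro k
    obtain ⟨n, hn, e, he, hne⟩ := hbranch k
    obtain ⟨j, q, hq⟩ := hcof (rng e) f hf
    obtain ⟨p, hp⟩ := reaches_seg src rng f hf k n hn
    obtain ⟨a, ha⟩ := reaches_seg src rng f hf (n + 1) (max j (n + 1)) (le_max_right _ _)
    obtain ⟨b, hb⟩ := reaches_seg src rng f hf j (max j (n + 1)) (le_max_left _ _)
    refine ⟨max j (n + 1), by omega, p ++ f n :: a, p ++ e :: (q ++ b), ?_, ?_, ?_⟩
    · intro h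
      have h2 := List.append_cancel_left h
      exact hne (List.cons.inj h2).1.symm
    · refine isPathFrom_append src rng _ _ _ _ _ hp ?_
      rw [isPathFrom_cons_iff, hf n]
      exact ⟨rfl, ha⟩
    · refine isPathFrom_append src rng _ _ _ _ _ hp ?_
      rw [isPathFrom_cons_iff]
      exact ⟨he, isPathFrom_append src rng _ _ _ _ _ hq hb⟩
  have hlt : ∀ a b : ℕ, a < b → src (f a) ≠ src (f b) := by
    intro a b hab h
    obtain ⟨l, hl⟩ := reaches_seg src rng f hf (a + 1) b hab
    refine hnc (src (f a)) (f a :: l) (by simp) ?_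
    rw [isPathFrom_cons_iff, hf a]
    exact ⟨rfl, by rw [h]; exact hl⟩
  choose g hg hpaths using key
  have hs : ∀ i, (g^[i + 1]) 0 = g (g^[i] 0) := fun i => Function.iterate_succ_apply' g i 0
  have hmono : StrictMono (fun i => g^[i] 0) := by
    refine strictMono_nat_of_lt_succ fun i => ?_
    simp only [hs]
    exact hg _
  refine ⟨fun i => g^[i] 0, hmono, ?_, ?_⟩
  · intro i j hij
    rcases lt_trichotomy i j with h | h | h
    · exact absurd hij (hlt _ _ (hmono h))
    · exact h
    · exact absurd hij.symm (hlt _ _ (hmono h))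
  · intro i
    simp only [hs]
    exact hpaths _
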